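/- arXiv:math/0703036 — 6 statements merged into one kernel-verified Lean document; each statement's English description precedes it below -/
import Mathlib

section
/- The assignments s_i(a_j) = a_j·a_i^{-a_{ij}} and s_i(f_j) = f_j·((a_i+f_i)/(1+a_i f_i))^{u_{ij}} (for i,j = 0,…,l) define field automorphisms s_0,…,s_l of F_cl that satisfy the Coxeter relations of the affine Weyl group of type A_l^{(1)} (namely s_i² = id, s_i s_j s_i = s_j s_i s_j when j ≡ i±1 mod l+1, and s_i s_j = s_j s_i otherwise), and hence give a group homomorphism from W(A_l^{(1)}) to the automorphism group of F_cl sending the i-th simple reflection to s_i. -/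
open MvPolynomial

/-- The field `F_cl = ℂ(a_0,…,a_l, f_0,…,f_l)` of rational functions in
`2(l+1)` commuting indeterminates. -/
abbrev Fcl (l : ℕ) : Type :=
  FractionRing (MvPolynomial (Fin (l + 1) ⊕ Fin (l + 1)) ℂ)

/-- The generator `a_j` of `F_cl`. -/
noncomputable def av (l : ℕ) (j : Fin (l + 1)) : Fcl l :=
  algebraMap (MvPolynomial (Fin (l + 1) ⊕ Fin (l + 1)) ℂ) (Fcl l) (X (Sum.inl j))

/-- The generator `f_j` of `F_cl`. -/
noncomputable def fv (l : ℕ) (j : Fin (l + 1)) : Fcl l :=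
  algebraMap (MvPolynomial (Fin (l + 1) ⊕ Fin (l + 1)) ℂ) (Fcl l) (X (Sum.inr j))

/-- The generalized Cartan matrix of affine type `A_l^(1)` (indices mod `l+1`). -/
def cartanA (l : ℕ) (i j : Fin (l + 1)) : ℤ :=
  if i = j then 2 else if j = i + 1 ∨ i = j + 1 then -1 else 0

/-- `u_{ij} = 1` if `j ≡ i+1`, `-1` if `j ≡ i-1`, `0` otherwise. -/
def uA (l : ℕ) (i j : Fin (l + 1)) : ℤ :=
  if j = i + 1 then 1 else if i = j + 1 then -1 else 0

/-- The Coxeter matrix of the affine Weyl group `W(A_l^(1))` (for `l ≥ 2`):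
`m_{ii} = 1`, `m_{ij} = 3` for adjacent indices mod `l+1`, `m_{ij} = 2`
otherwise. -/
def coxeterA (l : ℕ) : CoxeterMatrix (Fin (l + 1)) where
  M := Matrix.of fun i j => if i = j then 1 else if j = i + 1 ∨ i = j + 1 then 3 else 2
  isSymm := by
    ext i j
    simp only [Matrix.transpose_apply, Matrix.of_apply]
    by_cases h : i = j
    · subst h; simp
    · rw [if_neg h, if_neg (Ne.symm h)]
      by_cases h2 : j = i + 1 ∨ i = j + 1
      · rw [if_pos h2, if_pos (Or.symm h2)]
      · rw [if_neg h2, if_neg fun hc => h2 (Or.symm hc)]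
  diagonal := by intro i; simp
  off_diagonal := by
    intro i j h
    simp only [Matrix.of_apply]
    rw [if_neg h]
    split_ifs <;> omega

namespace MvPolynomial

variable {ι F : Type} [Field F]

/-- Generators of a purely transcendental field, as many as its transcendence degree,
are algebraically independent. -/
theorem algebraicIndependent_of_adjoin_eq_top [Finite ι]
    (y : ι → FractionRing (MvPolynomial ι F))
    (hy : IntermediateField.adjoin F (Set.range y) = ⊤) : AlgebraicIndependent F y := by
  have := IsLocalization.isAlgebraic (FractionRing (MvPolynomial ι F))
    (nonZeroDivisors (MvPolynomial ι F))
  have hx : IsTranscendenceBasis F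
      (algebraMap (MvPolynomial ι F) (FractionRing (MvPolynomial ι F)) ∘ X) :=
    (IsTranscendenceBasis.mvPolynomial ι F).algebraMap_comp
  have halg : Algebra.IsAlgebraic (Algebra.adjoin F (Set.range y))
      (FractionRing (MvPolynomial ι F)) := by
    refine ⟨fun z => ?_⟩
    have hz : z ∈ IntermediateField.adjoin F (Set.range y) := hy ▸ IntermediateField.mem_top
    obtain ⟨p, hp, q, hq, rfl⟩ := IntermediateField.mem_adjoin_iff_div.mp hz
    rw [div_eq_mul_inv]
    exact (isAlgebraic_algebraMap (⟨p, hp⟩ : Algebra.adjoin F (Set.range y))).mul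
      (isAlgebraic_algebraMap (⟨q, hq⟩ : Algebra.adjoin F (Set.range y))).inv
  exact (Algebra.IsAlgebraic.isTranscendenceBasis_of_le_trdeg_of_finite F y
    hx.cardinalMk_eq_trdeg.le).1

/-- Substituting a generating family of the field of rational functions for the indeterminates
gives a field endomorphism. -/
theorem exists_algHom_of_adjoin_eq_top [Finite ι]
    (y : ι → FractionRing (MvPolynomial ι F))
    (hy : IntermediateField.adjoin F (Set.range y) = ⊤) :
    ∃ φ : FractionRing (MvPolynomial ι F) →ₐ[F] FractionRing (MvPolynomial ι F),
      ∀ i, φ (algebraMap _ _ (X i : MvPolynomial ι F)) = y i := by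
  have h := algebraicIndependent_iff_injective_aeval.mp (algebraicIndependent_of_adjoin_eq_top y hy)
  refine ⟨IsFractionRing.liftAlgHom h, fun i => ?_⟩
  rw [IsFractionRing.liftAlgHom_apply, IsFractionRing.lift_algebraMap]
  simp

end MvPolynomial

section RationalIdentities

variable {K : Type*} [Field K]

theorem add_mul_div_div_one_add {d : K} (hd : d ≠ 0) (x y n : K) :
    (x + y * (n / d)) / (1 + x * (y * (n / d))) = (x * d + y * n) / (d + x * (y * n)) := by
  rw [← mul_div_mul_right _ _ hd]
  congr 1 <;> field_simp

theorem div_mul_mul_div_mul {n d : K} (hn : n ≠ 0) (hd : d ≠ 0) (u v : K) :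
    n / d * (d * u / (n * v)) = u / v := by
  field_simp

variable {s t : K →+* K} {a b f g : K}

/-- The braid relation for two adjacent reflections `s`, `t`, in terms of the factor
`(a + f) / (1 + a * f)` by which `s` modifies the remaining variables. -/
theorem reflection_factor_braid (ha : a ≠ 0) (hb : b ≠ 0)
    (h₁ : a + f ≠ 0) (h₂ : 1 + a * f ≠ 0) (h₃ : b + g ≠ 0) (h₄ : 1 + b * g ≠ 0)
    (sa : s a = a⁻¹) (sb : s b = b * a) (sf : s f = f) (sg : s g = g * ((a + f) / (1 + a * f)))
    (tb : t b = b⁻¹) (ta : t a = a * b) (tg : t g = g) (tf : t f = f * ((b + g) / (1 + b * g))⁻¹) :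
    (a + f) / (1 + a * f) * s (t ((a + f) / (1 + a * f))) = t ((a + f) / (1 + a * f)) ∧
    (b + g) / (1 + b * g) * t (s ((b + g) / (1 + b * g))) = s ((b + g) / (1 + b * g)) := by
  have hs : s ((b + g) / (1 + b * g)) =
      (b * a * (1 + a * f) + g * (a + f)) / (1 + a * f + b * a * (g * (a + f))) := by
    simp only [map_add, map_mul, map_one, map_div₀, sb, sg, add_mul_div_div_one_add h₂]
  have ht : t ((a + f) / (1 + a * f)) =
      (a * b * (b + g) + f * (1 + b * g)) / (b + g + a * b * (f * (1 + b * g))) := by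
    simp only [map_add, map_mul, map_one, map_div₀, ta, tf, inv_div, add_mul_div_div_one_add h₃]
  have hs₀ : s ((b + g) / (1 + b * g)) ≠ 0 := (map_ne_zero s).mpr (div_ne_zero h₃ h₄)
  have ht₀ : t ((a + f) / (1 + a * f)) ≠ 0 := (map_ne_zero t).mpr (div_ne_zero h₁ h₂)
  rw [hs, div_ne_zero_iff] at hs₀
  rw [ht, div_ne_zero_iff] at ht₀
  constructor
  · have e₁ : s (a * b) = b := by rw [map_mul, sa, sb]; field_simp
    have e₂ : s (f * ((b + g) / (1 + b * g))⁻¹) = f * ((1 + a * f + b * a * (g * (a + f))) /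
        (b * a * (1 + a * f) + g * (a + f))) := by rw [map_mul, map_inv₀, hs, sf, inv_div]
    have : s (t ((a + f) / (1 + a * f))) =
        (1 + a * f) * (a * b * (b + g) + f * (1 + b * g)) /
          ((a + f) * (b + g + a * b * (f * (1 + b * g)))) := by
      rw [map_div₀, map_add, map_add, map_one, map_mul, ta, tf, map_div₀, map_add, map_add,
        map_one, map_mul s (a * b), e₁, e₂, add_mul_div_div_one_add hs₀.1]
      congr 1 <;> ring
    rw [this, ht, div_mul_mul_div_mul h₁ h₂]
  · have e₁ : t (b * a) = a := by rw [map_mul, ta, tb]; field_simp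
    have e₂ : t (g * ((a + f) / (1 + a * f))) = g * ((a * b * (b + g) + f * (1 + b * g)) /
        (b + g + a * b * (f * (1 + b * g)))) := by rw [map_mul, ht, tg]
    have : t (s ((b + g) / (1 + b * g))) =
        (1 + b * g) * (b * a * (1 + a * f) + g * (a + f)) /
          ((b + g) * (1 + a * f + b * a * (g * (a + f)))) := by
      rw [map_div₀, map_add, map_add, map_one, map_mul, sb, sg, map_div₀, map_add, map_add,
        map_one, map_mul t (b * a), e₁, e₂, add_mul_div_div_one_add ht₀.2]
      congr 1 <;> ring
    rw [this, hs, div_mul_mul_div_mul h₃ h₄]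

end RationalIdentities

section Reflections

variable {l : ℕ}

theorem Fin.add_one_ne_self (hl : 2 ≤ l) (i : Fin (l + 1)) : i + 1 ≠ i := by
  obtain ⟨k, rfl⟩ := Nat.exists_eq_add_of_le' hl
  simp

theorem Fin.add_one_add_one_ne_self (hl : 2 ≤ l) (i : Fin (l + 1)) : i + 1 + 1 ≠ i := by
  obtain ⟨k, rfl⟩ := Nat.exists_eq_add_of_le' hl
  rw [add_assoc i 1 1, Ne, add_eq_left]
  exact Fin.ne_of_val_ne (by simp [Fin.val_add, Nat.mod_eq_of_lt])

theorem algebraMap_polynomial_ne_zero {p : MvPolynomial (Fin (l + 1) ⊕ Fin (l + 1)) ℂ}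
    (w : Fin (l + 1) ⊕ Fin (l + 1) → ℂ) (h : eval w p ≠ 0) : algebraMap _ (Fcl l) p ≠ 0 := by
  rw [Ne, FaithfulSMul.algebraMap_eq_zero_iff]
  rintro rfl
  simp at h

theorem av_ne_zero (i : Fin (l + 1)) : av l i ≠ 0 :=
  algebraMap_polynomial_ne_zero (fun _ => 1) (by simp)

theorem av_add_fv_ne_zero (i : Fin (l + 1)) : av l i + fv l i ≠ 0 := by
  rw [av, fv, ← map_add]
  exact algebraMap_polynomial_ne_zero (fun _ => 1) (by norm_num)

theorem one_add_av_mul_fv_ne_zero (i : Fin (l + 1)) : 1 + av l i * fv l i ≠ 0 := by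
  have h := algebraMap_polynomial_ne_zero (p := 1 + X (Sum.inl i) * X (Sum.inr i))
    (fun _ => 1) (by norm_num)
  rwa [map_add, map_one, map_mul] at h

/-- The factor by which `s_i` modifies the `f`-variables. -/
noncomputable def reflectionFactor (l : ℕ) (i : Fin (l + 1)) : Fcl l :=
  (av l i + fv l i) / (1 + av l i * fv l i)

theorem reflectionFactor_ne_zero (i : Fin (l + 1)) : reflectionFactor l i ≠ 0 :=
  div_ne_zero (av_add_fv_ne_zero i) (one_add_av_mul_fv_ne_zero i)

theorem intermediateField_eq_top_of_av_fv_mem (L : IntermediateField ℂ (Fcl l))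
    (ha : ∀ j, av l j ∈ L) (hf : ∀ j, fv l j ∈ L) : L = ⊤ := by
  have hp (p : MvPolynomial (Fin (l + 1) ⊕ Fin (l + 1)) ℂ) : algebraMap _ (Fcl l) p ∈ L := by
    induction p using MvPolynomial.induction_on with
    | C c => exact L.algebraMap_mem c
    | add p q hp hq => rw [map_add]; exact add_mem hp hq
    | mul_X p j hp =>
      rw [map_mul]
      exact mul_mem hp (j.rec ha hf)
  refine top_le_iff.mp fun z _ => ?_
  obtain ⟨p, q, -, rfl⟩ := IsFractionRing.div_surjective
    (A := MvPolynomial (Fin (l + 1) ⊕ Fin (l + 1)) ℂ) z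
  exact div_mem (hp p) (hp q)

theorem algHom_ext_av_fv {φ ψ : Fcl l →ₐ[ℂ] Fcl l} (ha : ∀ j, φ (av l j) = ψ (av l j))
    (hf : ∀ j, φ (fv l j) = ψ (fv l j)) : φ = ψ := by
  refine IsLocalization.algHom_ext
    (nonZeroDivisors (MvPolynomial (Fin (l + 1) ⊕ Fin (l + 1)) ℂ)) ?_
  refine MvPolynomial.algHom_ext fun j => ?_
  exact j.rec ha hf

/-- The endomorphism `φ` acts on the generators by the formulas defining `s_i`. -/
structure IsReflection (i : Fin (l + 1)) (φ : Fcl l →ₐ[ℂ] Fcl l) : Prop where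
  map_av (j : Fin (l + 1)) : φ (av l j) = av l j * av l i ^ (-(cartanA l i j))
  map_fv (j : Fin (l + 1)) : φ (fv l j) = fv l j * reflectionFactor l i ^ (uA l i j)

theorem cartanA_self (i : Fin (l + 1)) : cartanA l i i = 2 := if_pos rfl

theorem uA_self (hl : 2 ≤ l) (i : Fin (l + 1)) : uA l i i = 0 := by
  simp [uA, (Fin.add_one_ne_self hl i).symm]

theorem exists_isReflection (hl : 2 ≤ l) (i : Fin (l + 1)) :
    ∃ φ : Fcl l →ₐ[ℂ] Fcl l, IsReflection i φ := by
  let y : Fin (l + 1) ⊕ Fin (l + 1) → Fcl l :=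
    Sum.elim (fun j => av l j * av l i ^ (-(cartanA l i j)))
      (fun j => fv l j * reflectionFactor l i ^ (uA l i j))
  suffices h : IntermediateField.adjoin ℂ (Set.range y) = ⊤ by
    obtain ⟨φ, hφ⟩ := exists_algHom_of_adjoin_eq_top y h
    exact ⟨φ, fun j => hφ (Sum.inl j), fun j => hφ (Sum.inr j)⟩
  set L := IntermediateField.adjoin ℂ (Set.range y)
  have hy (j) : y j ∈ L := IntermediateField.subset_adjoin ℂ _ ⟨j, rfl⟩
  have hai : av l i ∈ L := by
    have h : (av l i * av l i ^ (-(cartanA l i i)))⁻¹ ∈ L := inv_mem (hy (Sum.inl i))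
    have := av_ne_zero i
    rw [cartanA_self] at h
    convert h using 1
    field_simp
  have hfi : fv l i ∈ L := by
    have h : fv l i * reflectionFactor l i ^ (uA l i i) ∈ L := hy (Sum.inr i)
    rwa [uA_self hl, zpow_zero, mul_one] at h
  have hR : reflectionFactor l i ∈ L :=
    div_mem (add_mem hai hfi) (add_mem (one_mem _) (mul_mem hai hfi))
  refine intermediateField_eq_top_of_av_fv_mem L (fun j => ?_) (fun j => ?_)
  · have h : av l j * av l i ^ (-(cartanA l i j)) / av l i ^ (-(cartanA l i j)) ∈ L :=
      div_mem (hy (Sum.inl j)) (zpow_mem hai _)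
    rwa [mul_div_cancel_right₀ _ (zpow_ne_zero _ (av_ne_zero i))] at h
  · have h : fv l j * reflectionFactor l i ^ (uA l i j) / reflectionFactor l i ^ (uA l i j) ∈ L :=
      div_mem (hy (Sum.inr j)) (zpow_mem hR _)
    rwa [mul_div_cancel_right₀ _ (zpow_ne_zero _ (reflectionFactor_ne_zero i))] at h

namespace IsReflection

variable {i j : Fin (l + 1)} {φ ψ : Fcl l →ₐ[ℂ] Fcl l}

theorem map_av_self (h : IsReflection i φ) : φ (av l i) = (av l i)⁻¹ := by
  have := av_ne_zero i
  rw [h.map_av, cartanA_self]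
  field_simp

theorem map_fv_self (hl : 2 ≤ l) (h : IsReflection i φ) : φ (fv l i) = fv l i := by
  rw [h.map_fv, uA_self hl, zpow_zero, mul_one]

theorem map_reflectionFactor_self (hl : 2 ≤ l) (h : IsReflection i φ) :
    φ (reflectionFactor l i) = (reflectionFactor l i)⁻¹ := by
  have := av_ne_zero i
  rw [reflectionFactor, map_div₀, map_add, map_add, map_mul, map_one, h.map_av_self,
    h.map_fv_self hl, inv_div, ← mul_div_mul_left _ _ this]
  congr 1 <;> field_simp

theorem comp_self (hl : 2 ≤ l) (h : IsReflection i φ) : φ.comp φ = AlgHom.id ℂ (Fcl l) := by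
  refine algHom_ext_av_fv (fun k => ?_) (fun k => ?_)
  · rw [AlgHom.comp_apply, h.map_av, map_mul, map_zpow₀, h.map_av, h.map_av_self, inv_zpow,
      mul_inv_cancel_right₀ (zpow_ne_zero _ (av_ne_zero i)), AlgHom.id_apply]
  · rw [AlgHom.comp_apply, h.map_fv, map_mul, map_zpow₀, h.map_fv, h.map_reflectionFactor_self hl,
      inv_zpow, mul_inv_cancel_right₀ (zpow_ne_zero _ (reflectionFactor_ne_zero i)),
      AlgHom.id_apply]

theorem comp_comp_of_adjacent (hl : 2 ≤ l) (h : IsReflection i φ) (h' : IsReflection (i + 1) ψ) :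
    φ.comp (ψ.comp φ) = ψ.comp (φ.comp ψ) := by
  have hne := Fin.add_one_ne_self hl i
  have hne' := Fin.add_one_add_one_ne_self hl i
  have ha := av_ne_zero i
  have hb := av_ne_zero (i + 1)
  have sb : φ (av l (i + 1)) = av l (i + 1) * av l i := by
    simp [h.map_av, cartanA, hne.symm]
  have ta : ψ (av l i) = av l i * av l (i + 1) := by
    simp [h'.map_av, cartanA, hne]
  have sg : φ (fv l (i + 1)) = fv l (i + 1) * reflectionFactor l i := by
    simp [h.map_fv, uA]
  have tf : ψ (fv l i) = fv l i * (reflectionFactor l (i + 1))⁻¹ := by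
    simp [h'.map_fv, uA, hne'.symm]
  obtain ⟨e₁, e₂⟩ := reflection_factor_braid (s := φ.toRingHom) (t := ψ.toRingHom) ha hb
    (av_add_fv_ne_zero i) (one_add_av_mul_fv_ne_zero i)
    (av_add_fv_ne_zero (i + 1)) (one_add_av_mul_fv_ne_zero (i + 1))
    h.map_av_self sb (h.map_fv_self hl) sg h'.map_av_self ta (h'.map_fv_self hl) tf
  change reflectionFactor l i * φ (ψ (reflectionFactor l i)) = ψ (reflectionFactor l i) at e₁
  change reflectionFactor l (i + 1) * ψ (φ (reflectionFactor l (i + 1))) =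
    φ (reflectionFactor l (i + 1)) at e₂
  refine algHom_ext_av_fv (fun k => ?_) (fun k => ?_)
  · simp only [AlgHom.comp_apply, h.map_av k, h'.map_av k, map_mul, map_zpow₀, ta, sb,
      h.map_av_self, h'.map_av_self, mul_zpow, inv_zpow]
    field_simp
  · simp only [AlgHom.comp_apply, h.map_fv k, h'.map_fv k, map_mul, map_zpow₀]
    have e₃ := congrArg (· ^ uA l i k) e₁
    have e₄ := congrArg (· ^ uA l (i + 1) k) e₂
    simp only [mul_zpow] at e₃ e₄
    linear_combination (fv l k * φ (reflectionFactor l (i + 1)) ^ uA l (i + 1) k) * e₃ -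
      (fv l k * ψ (reflectionFactor l i) ^ uA l i k) * e₄

theorem comp_comm_of_not_adjacent (hij : i ≠ j) (hadj : ¬(j = i + 1 ∨ i = j + 1))
    (h : IsReflection i φ) (h' : IsReflection j ψ) : φ.comp ψ = ψ.comp φ := by
  rw [not_or] at hadj
  have sb : φ (av l j) = av l j := by
    simp [h.map_av, cartanA, hij, hadj]
  have ta : ψ (av l i) = av l i := by
    simp [h'.map_av, cartanA, hij.symm, hadj]
  have sg : φ (fv l j) = fv l j := by
    simp [h.map_fv, uA, hadj]
  have tf : ψ (fv l i) = fv l i := by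
    simp [h'.map_fv, uA, hadj]
  have sR : φ (reflectionFactor l j) = reflectionFactor l j := by
    simp [reflectionFactor, sb, sg]
  have tR : ψ (reflectionFactor l i) = reflectionFactor l i := by
    simp [reflectionFactor, ta, tf]
  refine algHom_ext_av_fv (fun k => ?_) (fun k => ?_)
  · simp only [AlgHom.comp_apply, h.map_av k, h'.map_av k, map_mul, map_zpow₀, ta, sb]
    ring
  · simp only [AlgHom.comp_apply, h.map_fv k, h'.map_fv k, map_mul, map_zpow₀, sR, tR]
    ring

end IsReflection

end Reflections

theorem coxeterA_isLiftable {l : ℕ} {G : Type*} [Group G] {s : Fin (l + 1) → G}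
    (hsq : ∀ i, s i * s i = 1)
    (hbraid : ∀ i j, (j = i + 1 ∨ i = j + 1) → s i * s j * s i = s j * s i * s j)
    (hcomm : ∀ i j, i ≠ j → ¬(j = i + 1 ∨ i = j + 1) → s i * s j = s j * s i) :
    (coxeterA l).IsLiftable s := by
  intro i j
  simp only [coxeterA, Matrix.of_apply]
  split_ifs with hij hadj
  · rw [hij, pow_one, hsq]
  · calc
      (s i * s j) ^ 3 = s i * s j * s i * (s j * s i * s j) := by simp only [pow_three, mul_assoc]
      _ = s i * s j * (s i * s i) * s j * s i := by
        rw [← hbraid i j hadj]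
        simp only [mul_assoc]
      _ = 1 := by rw [hsq, mul_one, mul_assoc (s i), hsq, mul_one, hsq]
  · rw [pow_two]
    nth_rw 2 [hcomm i j hij hadj]
    rw [mul_assoc, ← mul_assoc (s j), hsq, one_mul, hsq]

/-- Kajiwara–Noumi–Yamada, case `A_l^(1)`: the assignments
`s_i(a_j) = a_j·a_i^{-a_{ij}}` and `s_i(f_j) = f_j·((a_i+f_i)/(1+a_i f_i))^{u_{ij}}`
define field automorphisms of `F_cl` satisfying the Coxeter relations of
`W(A_l^(1))`, hence a group homomorphism `W(A_l^(1)) → Aut(F_cl)` sending the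
`i`-th simple reflection to `s_i`. -/
theorem KNY_weyl_group_action (l : ℕ) (hl : 2 ≤ l) :
    ∃ s : Fin (l + 1) → RingAut (Fcl l),
      (∀ i j, s i (av l j) = av l j * av l i ^ (-(cartanA l i j))) ∧
      (∀ i j, s i (fv l j) =
        fv l j * ((av l i + fv l i) / (1 + av l i * fv l i)) ^ (uA l i j)) ∧
      (∀ i, s i * s i = 1) ∧
      (∀ i j, (j = i + 1 ∨ i = j + 1) → s i * s j * s i = s j * s i * s j) ∧
      (∀ i j, i ≠ j → ¬(j = i + 1 ∨ i = j + 1) → s i * s j = s j * s i) ∧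
      ∃ φ : (coxeterA l).Group →* RingAut (Fcl l),
        ∀ i, φ ((coxeterA l).simple i) = s i := by
  choose φ hφ using exists_isReflection hl
  let s (i : Fin (l + 1)) : RingAut (Fcl l) :=
    (AlgEquiv.ofAlgHom (φ i) (φ i) ((hφ i).comp_self hl) ((hφ i).comp_self hl)).toRingEquiv
  have hsq (i) : s i * s i = 1 := RingEquiv.ext fun x => DFunLike.congr_fun ((hφ i).comp_self hl) x
  have hadj (i) : s i * s (i + 1) * s i = s (i + 1) * s i * s (i + 1) := RingEquiv.ext fun x =>
    DFunLike.congr_fun ((hφ i).comp_comp_of_adjacent hl (hφ (i + 1))) x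
  have hbraid (i j) (h : j = i + 1 ∨ i = j + 1) : s i * s j * s i = s j * s i * s j := by
    rcases h with rfl | rfl
    exacts [hadj i, (hadj j).symm]
  have hcomm (i j) (hij : i ≠ j) (h : ¬(j = i + 1 ∨ i = j + 1)) : s i * s j = s j * s i :=
    RingEquiv.ext fun x =>
      DFunLike.congr_fun ((hφ i).comp_comm_of_not_adjacent hij h (hφ j)) x
  exact ⟨s, fun i => (hφ i).map_av, fun i => (hφ i).map_fv, hsq, hbraid, hcomm,
    (coxeterA l).toCoxeterSystem.lift ⟨s, coxeterA_isLiftable hsq hbraid hcomm⟩, fun i => by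
      rw [← CoxeterMatrix.toCoxeterSystem_simple, CoxeterSystem.lift_apply_simple]⟩
end

section
/- Each automorphism s_k is a Poisson map for the bracket {·,·}: for all φ, ψ ∈ F_cl and every k = 0,…,l, one has {s_k(φ), s_k(ψ)} = s_k({φ, ψ}). -/
open MvPolynomial

/-- Two `ℂ`-derivations of `F_cl` that agree on the generators are equal. -/
theorem Fcl.derivation_ext {l : ℕ} {D₁ D₂ : Derivation ℂ (Fcl l) (Fcl l)}
    (ha : ∀ j, D₁ (av l j) = D₂ (av l j)) (hf : ∀ j, D₁ (fv l j) = D₂ (fv l j)) :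
    D₁ = D₂ := by
  have hpoly : ∀ p : MvPolynomial (Fin (l + 1) ⊕ Fin (l + 1)) ℂ,
      D₁ (algebraMap _ (Fcl l) p) = D₂ (algebraMap _ (Fcl l) p) := by
    have h : D₁.compAlgebraMap (MvPolynomial (Fin (l + 1) ⊕ Fin (l + 1)) ℂ) =
        D₂.compAlgebraMap (MvPolynomial (Fin (l + 1) ⊕ Fin (l + 1)) ℂ) := by
      refine MvPolynomial.derivation_ext ?_
      rintro (j | j)
      · exact ha j
      · exact hf j
    exact fun p => DFunLike.congr_fun h p
  ext x
  obtain ⟨p, q, -, rfl⟩ := IsFractionRing.div_surjective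
    (A := MvPolynomial (Fin (l + 1) ⊕ Fin (l + 1)) ℂ) x
  rw [Derivation.leibniz_div, Derivation.leibniz_div, hpoly, hpoly]

/-- An automorphism of `F_cl` intertwines two derivations as soon as it does so on the
generators. -/
theorem Fcl.derivation_intertwine {l : ℕ} (s : Fcl l ≃ₐ[ℂ] Fcl l)
    (D₁ D₂ : Derivation ℂ (Fcl l) (Fcl l))
    (ha : ∀ j, D₁ (s (av l j)) = s (D₂ (av l j)))
    (hf : ∀ j, D₁ (s (fv l j)) = s (D₂ (fv l j))) (x : Fcl l) :
    D₁ (s x) = s (D₂ x) := by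
  let E : Derivation ℂ (Fcl l) (Fcl l) :=
    Derivation.mk' (s.symm.toLinearMap ∘ₗ D₁.toLinearMap ∘ₗ s.toLinearMap) fun a b => by
      simp
  have hE : ∀ y, E y = s.symm (D₁ (s y)) := fun _ => rfl
  have h : E = D₂ := Fcl.derivation_ext (fun j => by simp [hE, ha]) (fun j => by simp [hE, hf])
  rw [← h, hE, AlgEquiv.apply_symm_apply]

/-- The matrix `u` is skew-symmetric. -/
theorem uA_skew {l : ℕ} (hl : 2 ≤ l) (i j : Fin (l + 1)) : uA l j i = -uA l i j := by
  have h : ¬ (j = i + 1 ∧ i = j + 1) := by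
    rintro ⟨h₁, h₂⟩
    have h₃ : (1 : Fin (l + 1)) + 1 = 0 := by
      rw [h₁, add_assoc] at h₂
      exact left_eq_add.mp h₂
    have h₄ := congrArg Fin.val h₃
    rw [Fin.val_add, Fin.val_one', Fin.val_zero, Nat.mod_eq_of_lt (by omega : 1 < l + 1),
      Nat.mod_eq_of_lt (by omega)] at h₄
    omega
  unfold uA
  split_ifs <;> first | rfl | exact absurd (And.intro (by assumption) (by assumption)) h

/-- A derivation killing `a` and `b` kills `a * b ^ n`. -/
theorem Derivation.map_mul_zpow_eq_zero {K : Type*} [Field K] [Algebra ℂ K]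
    (D : Derivation ℂ K K) {a b : K} (ha : D a = 0) (hb : D b = 0) (n : ℤ) :
    D (a * b ^ n) = 0 := by
  simp [Derivation.leibniz_zpow, ha, hb]

/-- The derivative of `a * b ^ n`, in terms of the logarithmic derivative of `b`. -/
theorem Derivation.map_mul_zpow {K : Type*} [Field K] [Algebra ℂ K]
    (D : Derivation ℂ K K) (a : K) {b : K} (hb : b ≠ 0) (n : ℤ) :
    D (a * b ^ n) = D a * b ^ n + a * b ^ n * (n * (D b / b)) := by
  rw [Derivation.leibniz, Derivation.leibniz_zpow, zpow_sub_one₀ hb]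
  simp only [smul_eq_mul, zsmul_eq_mul]
  ring

/-- A finite sum of derivations is evaluated pointwise. -/
theorem Derivation.sum_apply {ι K : Type*} [Field K] [Algebra ℂ K] (t : Finset ι)
    (D : ι → Derivation ℂ K K) (x : K) : (∑ i ∈ t, D i) x = ∑ i ∈ t, D i x :=
  map_sum ((Pi.evalAddMonoidHom (fun _ : K => K) x).comp Derivation.coeFnAddMonoidHom) D t

/-- each automorphism `s_k` is a Poisson map for the bracket
`{φ, ψ} := Σ_{i,j} u_{ij} f_i f_j (∂φ/∂f_i)(∂ψ/∂f_j)`, where `∂/∂f_i` is the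
unique extension to `F_cl` of the partial derivative with respect to `f_i`
(formalized as a `ℂ`-derivation `Df i` which kills the `a_j` and sends `f_j`
to `δ_{ij}`). -/
theorem KNY_poisson_map (l : ℕ) (hl : 2 ≤ l)
    (s : Fin (l + 1) → (Fcl l ≃ₐ[ℂ] Fcl l))
    (hsa : ∀ i j, s i (av l j) = av l j * av l i ^ (-(cartanA l i j)))
    (hsf : ∀ i j, s i (fv l j) =
      fv l j * ((av l i + fv l i) / (1 + av l i * fv l i)) ^ (uA l i j))
    (Df : Fin (l + 1) → Derivation ℂ (Fcl l) (Fcl l))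
    (hDf : ∀ i j, Df i (fv l j) = if i = j then 1 else 0)
    (hDa : ∀ i j, Df i (av l j) = 0) :
    ∀ (k : Fin (l + 1)) (φ ψ : Fcl l),
      (∑ i, ∑ j, (uA l i j : Fcl l) * fv l i * fv l j * Df i (s k φ) * Df j (s k ψ))
        = s k (∑ i, ∑ j,
            (uA l i j : Fcl l) * fv l i * fv l j * Df i φ * Df j ψ) := by
  intro k φ ψ
  set g : Fcl l := (av l k + fv l k) / (1 + av l k * fv l k) with hg
  have hfv : ∀ j, fv l j ≠ 0 := fun j => by
    simp [fv, MvPolynomial.X_ne_zero]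
  have hg0 : g ≠ 0 := by
    intro h0
    have h := hsf k (k + 1)
    rw [← hg, h0, show uA l k (k + 1) = 1 by simp [uA], zpow_one, mul_zero] at h
    exact hfv (k + 1) ((map_eq_zero (s k)).mp h)
  have hDsa : ∀ i j, Df i (s k (av l j)) = 0 := fun i j => by
    rw [hsa]
    exact (Df i).map_mul_zpow_eq_zero (hDa i j) (hDa i k) _
  have hDg : ∀ i, i ≠ k → Df i g = 0 := fun i hi => by
    rw [hg, Derivation.leibniz_div]
    simp [hDa, hDf, hi]
  obtain ⟨c, hc⟩ : ∃ c : Fcl l, c = fv l k * (Df k g / g) := ⟨_, rfl⟩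
  have hlog : ∀ i j, fv l i * Df i (s k (fv l j)) =
      s k (fv l j) * ((if i = j then 1 else 0) + if i = k then (uA l k j : Fcl l) * c else 0) := by
    intro i j
    rw [hsf, ← hg, (Df i).map_mul_zpow _ hg0, hDf]
    by_cases hik : i = k
    · subst hik
      by_cases hij : i = j
      · subst hij
        simp only [if_true, hc]
        ring
      · simp only [if_true, if_neg hij, hc]
        ring
    · rw [hDg i hik]
      by_cases hij : i = j
      · subst hij
        simp [hik]
      · simp [hik, hij]
  have hskew : ∀ i j, (uA l j i : Fcl l) = -(uA l i j : Fcl l) := fun i j => by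
    rw [uA_skew hl i j, Int.cast_neg]
  have hkk : (uA l k k : Fcl l) = 0 := by
    have h : uA l k k = 0 := by
      have := uA_skew hl k k
      omega
    rw [h, Int.cast_zero]
  have hgen : ∀ m n, (∑ i, ∑ j, (uA l i j : Fcl l) * fv l i * fv l j *
        Df i (s k (fv l m)) * Df j (s k (fv l n))) =
      uA l m n * s k (fv l m) * s k (fv l n) := by
    intro m n
    have : ∀ i j, (uA l i j : Fcl l) * fv l i * fv l j *
        Df i (s k (fv l m)) * Df j (s k (fv l n)) =
        s k (fv l m) * s k (fv l n) * (uA l i j *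
          ((if i = m then 1 else 0) + if i = k then (uA l k m : Fcl l) * c else 0) *
          ((if j = n then 1 else 0) + if j = k then (uA l k n : Fcl l) * c else 0)) := by
      intro i j
      linear_combination (uA l i j * fv l j * Df j (s k (fv l n))) * hlog i m +
        (uA l i j * s k (fv l m) *
          ((if i = m then 1 else 0) + if i = k then (uA l k m : Fcl l) * c else 0)) * hlog j n
    simp only [this, ← Finset.mul_sum]
    simp only [mul_add, add_mul, Finset.sum_add_distrib, mul_ite, ite_mul, mul_zero, zero_mul,
      mul_one, Finset.sum_ite_eq', Finset.mem_univ, if_true]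
    rw [hkk, hskew k m]
    ring
  let P : Fcl l → Derivation ℂ (Fcl l) (Fcl l) := fun χ =>
    ∑ i, ∑ j, ((uA l i j : Fcl l) * fv l i * fv l j * Df j χ) • Df i
  let Q : Fcl l → Derivation ℂ (Fcl l) (Fcl l) := fun χ =>
    ∑ i, ∑ j, ((uA l i j : Fcl l) * fv l i * fv l j * Df i χ) • Df j
  have hP : ∀ χ ω, P χ ω =
      ∑ i, ∑ j, (uA l i j : Fcl l) * fv l i * fv l j * Df i ω * Df j χ := fun χ ω => by
    simp only [P, Derivation.sum_apply, Derivation.coe_smul, Pi.smul_apply,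
      smul_eq_mul, mul_right_comm]
  have hQ : ∀ χ ω, Q χ ω =
      ∑ i, ∑ j, (uA l i j : Fcl l) * fv l i * fv l j * Df i χ * Df j ω := fun χ ω => by
    simp only [Q, Derivation.sum_apply, Derivation.coe_smul, Pi.smul_apply,
      smul_eq_mul]
  rw [← hP, ← hP]
  refine Fcl.derivation_intertwine (s k) _ _ (fun m => ?_) (fun m => ?_) φ
  · simp [hP, hDsa, hDa]
  · rw [hP, hP, ← hQ, ← hQ]
    refine Fcl.derivation_intertwine (s k) _ _ (fun n => ?_) (fun n => ?_) ψ
    · simp [hQ, hDsa, hDa]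
    · rw [hQ, hQ, hgen]
      simp [hDf]
end

section
/- Each quantized transformation is an involution on generators: for every i and every x ∈ {a_0,…,a_l, F_0,…,F_l}, one has s_i(s_i(x)) = x. -/
theorem add_one_ne_self_of_two_le {l : ℕ} (hl : 2 ≤ l) (i : Fin (l + 1)) : i ≠ i + 1 := by
  intro h
  have h1 : (1 : Fin (l + 1)) = 0 := by simpa using h.symm
  have := congrArg Fin.val h1
  rw [Fin.val_one', Nat.mod_eq_of_lt (by omega)] at this
  simp at this

theorem mul_inv_apply_of_apply_eq_inv_mul {D : Type*} [DivisionRing D] (s : D ≃+* D) {a x y : D}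
    (ha : a ≠ 0) (hac : ∀ z, a * z = z * a) (hx : s x = a⁻¹ * y) (hy : s y = a⁻¹ * x) :
    s (x * y⁻¹) = y * x⁻¹ := by
  rw [map_mul, map_inv₀, hx, hy, mul_inv_rev, inv_inv, ← hac x⁻¹, mul_assoc a⁻¹ y, ← mul_assoc y,
    ← hac y, mul_assoc a, inv_mul_cancel_left₀ ha]


/-- each quantized transformation `s_i` is an involution on the
generators `a_0,…,a_l, F_0,…,F_l`. -/
theorem quantized_sInvolution {D : Type*} [DivisionRing D] (l : ℕ) (hl : 2 ≤ l)
    (q : D) (a F : Fin (l + 1) → D)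
    (hq : q ≠ 0) (hqc : ∀ x, q * x = x * q)
    (ha : ∀ i, a i ≠ 0) (hac : ∀ i x, a i * x = x * a i)
    (hF : ∀ i, F i ≠ 0)
    (hFF : ∀ i, F i * F (i + 1) = q⁻¹ * (F (i + 1) * F i))
    (hFcomm : ∀ i j, j ≠ i + 1 → i ≠ j + 1 → F i * F j = F j * F i)
    (s : Fin (l + 1) → (D ≃+* D)) (hsq : ∀ i, s i q = q)
    (hsa : ∀ i j, s i (a j) = a i ^ (-(cartanA l i j)) * a j)
    (hsFl : ∀ i, s i (F (i - 1)) = (1 + a i * F i) * (a i + F i)⁻¹ * F (i - 1))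
    (hsFr : ∀ i, s i (F (i + 1)) = F (i + 1) * ((a i + F i) * (1 + a i * F i)⁻¹))
    (hsF : ∀ i j, j ≠ i + 1 → i ≠ j + 1 → s i (F j) = F j) :
    ∀ i j, s i (s i (a j)) = a j ∧ s i (s i (F j)) = F j := by
  intro i j
  have hi := add_one_ne_self_of_two_le hl i
  have hsai : s i (a i) = (a i)⁻¹ := by
    rw [hsa, cartanA, if_pos rfl, ← zpow_add_one₀ (ha i)]
    norm_num
  have hsFi : s i (F i) = F i := hsF i i hi hi
  have hL : (1 + a i * F i) * (a i + F i)⁻¹ ≠ 0 := by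
    intro h
    have := hsFl i
    rw [h, zero_mul, map_eq_zero_iff _ (s i).injective] at this
    exact hF _ this
  have hx : 1 + a i * F i ≠ 0 := left_ne_zero_of_mul hL
  have hy : a i + F i ≠ 0 := fun h => hL (by rw [h, inv_zero, mul_zero])
  have hsx : s i (1 + a i * F i) = (a i)⁻¹ * (a i + F i) := by
    rw [map_add, map_one, map_mul, hsai, hsFi, mul_add, inv_mul_cancel₀ (ha i)]
  have hsy : s i (a i + F i) = (a i)⁻¹ * (1 + a i * F i) := by
    rw [map_add, hsai, hsFi, mul_add, mul_one, inv_mul_cancel_left₀ (ha i)]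
  constructor
  · rw [hsa i j, map_mul, map_zpow₀, hsai, hsa i j, inv_zpow,
      inv_mul_cancel_left₀ (zpow_ne_zero _ (ha i))]
  · by_cases h1 : j = i + 1
    · subst h1
      rw [hsFr, map_mul, mul_inv_apply_of_apply_eq_inv_mul (s i) (ha i) (hac i) hsy hsx, hsFr,
        mul_assoc, mul_assoc (a i + F i), inv_mul_cancel_left₀ hx, mul_inv_cancel₀ hy, mul_one]
    · by_cases h2 : i = j + 1
      · obtain rfl : j = i - 1 := by rw [h2, add_sub_cancel_right]
        rw [hsFl, map_mul, mul_inv_apply_of_apply_eq_inv_mul (s i) (ha i) (hac i) hsx hsy, hsFl,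
          ← mul_assoc, mul_assoc (a i + F i), inv_mul_cancel_left₀ hx, mul_inv_cancel₀ hy, one_mul]
      · rw [hsF i j h1 h2, hsF i j h1 h2]
end

section
/- The quantized transformations satisfy the affine Weyl group relations of type A_l^{(1)} on generators: for j ≡ i+1 (mod l+1), s_i(s_j(s_i(x))) = s_j(s_i(s_j(x))) for every x ∈ {a_0,…,a_l, F_0,…,F_l}, and for j ≢ i±1 (mod l+1), s_i(s_j(x)) = s_j(s_i(x)) for every such x. -/
theorem mul_left_comm_of_central {R : Type*} [Semigroup R] {a : R} (ha : ∀ x, a * x = x * a)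
    (x y : R) : x * (a * y) = a * (x * y) := by
  rw [← mul_assoc, ← ha, mul_assoc]

/-- The two factors of each multiplier commute. -/
theorem commute_one_add_mul_add {R : Type*} [Semiring R] {b : R} (hb : ∀ x, b * x = x * b)
    (G : R) : Commute (1 + b * G) (b + G) := by
  have h₁ : Commute b (b + G) := hb _
  have h₂ : Commute G (b + G) := (show Commute G b from (hb G).symm).add_right rfl
  exact (Commute.one_left _).add_left (h₁.mul_left h₂)

theorem commute_mul_inv_self {D : Type*} [DivisionRing D] {a : D} (ha : ∀ x, a * x = x * a)
    (F : D) : Commute ((a + F) * (1 + a * F)⁻¹) F := by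
  have haF : Commute a F := ha F
  exact (haF.add_left rfl).mul_left
    (((Commute.one_left F).add_left (haF.mul_left rfl)).inv_left₀)

/-- For adjacent indices `j = i + 1`, the right multiplier `T` of `s_i` satisfies
`s_i (s_j T) = T⁻¹ s_j T`; here `σ = s_i` and `τ = s_j`. -/
theorem apply_apply_right_multiplier {D : Type*} [DivisionRing D] (σ τ : D ≃+* D) {a b F G : D}
    (ha : a ≠ 0) (hac : ∀ x, a * x = x * a) (hbc : ∀ x, b * x = x * b)
    (hσa : σ a = a⁻¹) (hσb : σ b = a * b) (hτa : τ a = a * b)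
    (hσF : σ F = F) (hG : G ≠ 0) (hF : F ≠ 0)
    (hσG : σ G = G * ((a + F) * (1 + a * F)⁻¹))
    (hτF : τ F = (1 + b * G) * (b + G)⁻¹ * F) :
    σ (τ ((a + F) * (1 + a * F)⁻¹)) =
      ((a + F) * (1 + a * F)⁻¹)⁻¹ * τ ((a + F) * (1 + a * F)⁻¹) := by
  have hS : 1 + a * F ≠ 0 := fun h => hG (by simpa [h] using hσG)
  have hQ : b + G ≠ 0 := fun h => hF (by simpa [h] using hτF)
  have la := mul_left_comm_of_central hac
  have lb := mul_left_comm_of_central hbc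
  have hQU : (b + G) * ((1 + b * G) * (b + G)⁻¹) = 1 + b * G := by
    rw [(commute_one_add_mul_add hbc G).inv_right₀.eq, mul_inv_cancel_left₀ hQ]
  have hN : τ (1 + a * F) = (b + G)⁻¹ * (b + G + a * b * ((1 + b * G) * F)) := by
    rw [eq_inv_mul_iff_mul_eq₀ hQ, map_add, map_mul, map_one, hτa, hτF, mul_add, mul_one, mul_assoc a,
      la, lb, ← mul_assoc (b + G) (_ * _), hQU, mul_assoc a]
  have hM : τ (a + F) = (b + G)⁻¹ * (a * b * (b + G) + (1 + b * G) * F) := by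
    rw [eq_inv_mul_iff_mul_eq₀ hQ, map_add, hτa, hτF, mul_add, ← mul_assoc (b + G) (_ * _),
      hQU, la, ← hbc, mul_assoc]
  have cτ : Commute (τ (a + F)) (τ (1 + a * F))⁻¹ :=
    ((commute_one_add_mul_add hac F).symm.map τ).inv_right₀
  have key : τ ((a + F) * (1 + a * F)⁻¹) = (b + G + a * b * ((1 + b * G) * F))⁻¹ *
      (a * b * (b + G) + (1 + b * G) * F) := by
    rw [map_mul, map_inv₀, cτ.eq, hN, hM, mul_inv_rev, inv_inv, mul_assoc,
      mul_inv_cancel_left₀ hQ]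
  have hTS : (a + F) * (1 + a * F)⁻¹ * (1 + a * F) = a + F := inv_mul_cancel_right₀ hS _
  have hTF : (a + F) * (1 + a * F)⁻¹ * F = F * ((a + F) * (1 + a * F)⁻¹) :=
    commute_mul_inv_self hac F
  generalize (a + F) * (1 + a * F)⁻¹ = T at *
  have haTF (x : D) : a * (x * (F * T)) = x * a + x * F - x * T := by
    rw [← la, ← mul_add, ← mul_sub, ← hTS, ← hTF, mul_add, mul_one, la T, add_sub_cancel_left]
  have hσN : σ (b + G + a * b * ((1 + b * G) * F)) =
      (b + G + a * b * ((1 + b * G) * F)) * T := by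
    simp only [map_add, map_mul, map_one, hσa, hσF, hσG, hσb, inv_mul_cancel_left₀ ha]
    simp only [mul_add, add_mul, mul_assoc, one_mul, hTF, haTF]
    simp only [hac b, la b]
    abel
  have hσM : σ (a * b * (b + G) + (1 + b * G) * F) = a * b * (b + G) + (1 + b * G) * F := by
    simp only [map_add, map_mul, map_one, hσa, hσF, hσG, hσb, inv_mul_cancel_left₀ ha]
    simp only [mul_add, add_mul, mul_assoc, one_mul, hTF, la b]
    have := haTF (b * G)
    simp only [mul_assoc] at this
    simp only [this, ← hac G, la b]
    abel
  rw [key, map_mul, map_inv₀, hσN, hσM, mul_inv_rev, mul_assoc]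

/-- For adjacent indices `j = i + 1`, the left multiplier `U` of `s_j` satisfies
`s_j (s_i U) = s_i U U⁻¹`; here `σ = s_i` and `τ = s_j`. -/
theorem apply_apply_left_multiplier {D : Type*} [DivisionRing D] (σ τ : D ≃+* D) {a b F G : D}
    (hb : b ≠ 0) (hac : ∀ x, a * x = x * a) (hbc : ∀ x, b * x = x * b)
    (hσb : σ b = a * b) (hτa : τ a = a * b) (hτb : τ b = b⁻¹)
    (hτG : τ G = G) (hG : G ≠ 0) (hF : F ≠ 0)
    (hσG : σ G = G * ((a + F) * (1 + a * F)⁻¹))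
    (hτF : τ F = (1 + b * G) * (b + G)⁻¹ * F) :
    τ (σ ((1 + b * G) * (b + G)⁻¹)) =
      σ ((1 + b * G) * (b + G)⁻¹) * ((1 + b * G) * (b + G)⁻¹)⁻¹ := by
  have hS : 1 + a * F ≠ 0 := fun h => hG (by simpa [h] using hσG)
  have hQ : b + G ≠ 0 := fun h => hF (by simpa [h] using hτF)
  have la := mul_left_comm_of_central hac
  have lb := mul_left_comm_of_central hbc
  have hTS : (a + F) * (1 + a * F)⁻¹ * (1 + a * F) = a + F := inv_mul_cancel_right₀ hS _
  have hX : σ (1 + b * G) = (1 + a * F + a * b * (G * (a + F))) * (1 + a * F)⁻¹ := by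
    rw [eq_mul_inv_iff_mul_eq₀ hS, map_add, map_mul, map_one, hσb, hσG, add_mul, one_mul,
      mul_assoc (a * b), mul_assoc G, hTS]
  have hY : σ (b + G) = (a * b * (1 + a * F) + G * (a + F)) * (1 + a * F)⁻¹ := by
    rw [eq_mul_inv_iff_mul_eq₀ hS, map_add, hσb, hσG, add_mul, mul_assoc G, hTS]
  have key : σ ((1 + b * G) * (b + G)⁻¹) = (1 + a * F + a * b * (G * (a + F))) *
      (a * b * (1 + a * F) + G * (a + F))⁻¹ := by
    rw [map_mul, map_inv₀, hX, hY, mul_inv_rev, inv_inv, mul_assoc, inv_mul_cancel_left₀ hS]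
  have hQU : (b + G) * ((1 + b * G) * (b + G)⁻¹) = 1 + b * G := by
    rw [(commute_one_add_mul_add hbc G).inv_right₀.eq, mul_inv_cancel_left₀ hQ]
  have hUQ : (1 + b * G) * (b + G)⁻¹ * (b + G) = 1 + b * G := inv_mul_cancel_right₀ hQ _
  generalize (1 + b * G) * (b + G)⁻¹ = U at *
  have hGU : G * U = 1 + b * G - b * U := by rw [← hQU, add_mul, add_sub_cancel_left]
  have hUG : U * G = 1 + b * G - b * U := by rw [← hUQ, mul_add, hbc U, add_sub_cancel_left]
  have hGUF : G * (U * F) = F + b * (G * F) - b * (U * F) := by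
    rw [← mul_assoc, hGU, sub_mul, add_mul, one_mul, mul_assoc, mul_assoc]
  have hUGF : U * (G * F) = F + b * (G * F) - b * (U * F) := by
    rw [← mul_assoc, hUG, sub_mul, add_mul, one_mul, mul_assoc, mul_assoc]
  have hτX : τ (1 + a * F + a * b * (G * (a + F))) = 1 + a * F + a * b * (G * (a + F)) := by
    simp only [map_add, map_mul, map_one, hτa, hτb, hτF, hτG, mul_inv_cancel_right₀ hb]
    simp only [mul_add, mul_sub, mul_assoc, hGUF, la G, ← hac G, ← hbc G, la b]
    abel
  have hτY : τ (a * b * (1 + a * F) + G * (a + F)) =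
      U * (a * b * (1 + a * F) + G * (a + F)) := by
    simp only [map_add, map_mul, map_one, hτa, hτb, hτF, hτG, mul_inv_cancel_right₀ hb]
    simp only [mul_add, mul_sub, mul_assoc, mul_one, hGUF, hUGF, hUG, la G, la U, lb U,
      ← hac G, ← hbc G, ← hbc U, la b]
    abel
  rw [key, map_mul, map_inv₀, hτX, hτY, mul_inv_rev, ← mul_assoc]


/-- the quantized transformations satisfy the affine Weyl group
relations of type `A_l^(1)` on the generators: the braid relation for adjacent
indices and commutativity for non-adjacent indices. -/
theorem quantized_weyl_relations {D : Type*} [DivisionRing D] (l : ℕ) (hl : 2 ≤ l)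
    (q : D) (a F : Fin (l + 1) → D)
    (hq : q ≠ 0) (hqc : ∀ x, q * x = x * q)
    (ha : ∀ i, a i ≠ 0) (hac : ∀ i x, a i * x = x * a i)
    (hF : ∀ i, F i ≠ 0)
    (hFF : ∀ i, F i * F (i + 1) = q⁻¹ * (F (i + 1) * F i))
    (hFcomm : ∀ i j, j ≠ i + 1 → i ≠ j + 1 → F i * F j = F j * F i)
    (s : Fin (l + 1) → (D ≃+* D)) (hsq : ∀ i, s i q = q)
    (hsa : ∀ i j, s i (a j) = a i ^ (-(cartanA l i j)) * a j)
    (hsFl : ∀ i, s i (F (i - 1)) = (1 + a i * F i) * (a i + F i)⁻¹ * F (i - 1))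
    (hsFr : ∀ i, s i (F (i + 1)) = F (i + 1) * ((a i + F i) * (1 + a i * F i)⁻¹))
    (hsF : ∀ i j, j ≠ i + 1 → i ≠ j + 1 → s i (F j) = F j) :
    (∀ i j, j = i + 1 →
      ∀ k, s i (s j (s i (a k))) = s j (s i (s j (a k))) ∧
           s i (s j (s i (F k))) = s j (s i (s j (F k)))) ∧
    (∀ i j, j ≠ i + 1 → i ≠ j + 1 →
      ∀ k, s i (s j (a k)) = s j (s i (a k)) ∧
           s i (s j (F k)) = s j (s i (F k))) := by
  have hne (i : Fin (l + 1)) : i ≠ i + 1 := by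
    simp only [ne_eq, left_eq_add, Fin.one_eq_zero_iff]
    omega
  have hs_left (i k) (h : i = k + 1) :
      s i (F k) = (1 + a i * F i) * (a i + F i)⁻¹ * F k := by
    simpa [h] using hsFl i
  have hs_right (i k) (h : k = i + 1) :
      s i (F k) = F k * ((a i + F i) * (1 + a i * F i)⁻¹) := h ▸ hsFr i
  have hs_self (i) : s i (F i) = F i := hsF i i (hne i) (hne i)
  have hsa_self (i) : s i (a i) = (a i)⁻¹ := by
    rw [hsa, cartanA, if_pos rfl, zpow_neg, zpow_ofNat, sq, mul_inv_rev, mul_assoc,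
      inv_mul_cancel₀ (ha i), mul_one]
  have hsa_adj (i j) (hij : i ≠ j) (h : j = i + 1 ∨ i = j + 1) : s i (a j) = a i * a j := by
    rw [hsa, cartanA, if_neg hij, if_pos h, neg_neg, zpow_one]
  have hsa_far (i j) (hij : i ≠ j) (h₁ : j ≠ i + 1) (h₂ : i ≠ j + 1) : s i (a j) = a j := by
    rw [hsa, cartanA, if_neg hij, if_neg (by tauto), neg_zero, zpow_zero, one_mul]
  have hzc (i) (n : ℤ) (x : D) : Commute (a i ^ n) x := Commute.zpow_left₀ (hac i x) n
  refine ⟨?_, ?_⟩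
  · rintro i j hj k
    have hij : i ≠ j := hj ▸ hne i
    have hab : s i (a j) = a i * a j := hsa_adj i j hij (.inl hj)
    have hba : s j (a i) = a i * a j := by rw [hsa_adj j i hij.symm (.inr hj), hac]
    have hT := apply_apply_right_multiplier (s i) (s j) (ha i) (hac i) (hac j) (hsa_self i) hab
      hba (hs_self i) (hF j) (hF i) (hs_right i j hj) (hs_left j i hj)
    have hU := apply_apply_left_multiplier (s i) (s j) (ha j) (hac i) (hac j) hab
      hba (hsa_self j) (hs_self j) (hF j) (hF i) (hs_right i j hj) (hs_left j i hj)
    have hGT := hs_right i j hj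
    have hUF := hs_left j i hj
    have hi_left (h : i = k + 1) := hs_left i k h
    have hj_right (h : k = j + 1) := hs_right j k h
    have hT0 : (a i + F i) * (1 + a i * F i)⁻¹ ≠ 0 := fun h => hF j (by simpa [h] using hGT)
    have hU0 : (1 + a j * F j) * (a j + F j)⁻¹ ≠ 0 := fun h => hF i (by simpa [h] using hUF)
    have hTinv : (1 + a i * F i) * (a i + F i)⁻¹ = ((a i + F i) * (1 + a i * F i)⁻¹)⁻¹ := by
      rw [mul_inv_rev, inv_inv]
    have hUinv : (a j + F j) * (1 + a j * F j)⁻¹ = ((1 + a j * F j) * (a j + F j)⁻¹)⁻¹ := by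
      rw [mul_inv_rev, inv_inv]
    rw [hTinv] at hi_left
    rw [hUinv] at hj_right
    generalize (a i + F i) * (1 + a i * F i)⁻¹ = T at *
    generalize (1 + a j * F j) * (a j + F j)⁻¹ = U at *
    constructor
    · have h₁ : s i (a i * a j) = a j := by
        rw [map_mul, hsa_self, hab, inv_mul_cancel_left₀ (ha i)]
      have h₂ : s j (a i * a j) = a i := by
        rw [map_mul, hsa_self, hba, mul_assoc, mul_inv_cancel₀ (ha j), mul_one]
      simp only [hsa i k, hsa j k, map_mul, map_zpow₀, hba, hab, h₁, h₂]
      have hcomm (i) (n : ℤ) := mul_left_comm_of_central (hzc i n)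
      simp only [(show Commute (a i) (a j) from hac i _).mul_zpow, mul_assoc]
      rw [hcomm i _ (a j ^ _), hcomm i (-cartanA l i k) (a j ^ _),
        hcomm i (-cartanA l i k) (a j ^ _)]
    · rcases eq_or_ne k i with rfl | hki
      · rw [hs_self, hUF, map_mul, map_mul, hs_self, hU, hUF, mul_assoc,
          inv_mul_cancel_left₀ hU0]
      rcases eq_or_ne k j with rfl | hkj
      · rw [hs_self, hGT, map_mul, map_mul, hs_self, hT, hGT, mul_assoc,
          mul_inv_cancel_left₀ hT0]
      obtain ⟨x, hx, hxT⟩ : ∃ x, s i (F k) = x * F k ∧ s i (s j x) * x = s j x := by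
        by_cases h : i = k + 1
        · refine ⟨T⁻¹, hi_left h, ?_⟩
          have hT' : s j T ≠ 0 := by simpa using hT0
          rw [map_inv₀, map_inv₀, hT, mul_inv_rev, inv_inv, mul_assoc, mul_inv_cancel₀ hT0,
            mul_one]
        · exact ⟨1, by rw [one_mul, hsF i k (hj ▸ hkj) h], by simp⟩
      obtain ⟨y, hy, hyU⟩ : ∃ y, s j (F k) = F k * y ∧ y * s j (s i y) = s i y := by
        by_cases h : k = j + 1
        · refine ⟨U⁻¹, hj_right h, ?_⟩
          rw [map_inv₀, map_inv₀, hU, mul_inv_rev, inv_inv, inv_mul_cancel_left₀ hU0]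
        · refine ⟨1, ?_, by simp⟩
          rw [mul_one, hsF j k h (fun h' => hki (add_right_cancel (h'.symm.trans hj)))]
      simp only [hx, hy, map_mul]
      rw [← mul_assoc, ← mul_assoc, hxT, mul_assoc (s j x), mul_assoc (s j x), mul_assoc (F k),
        hyU]
  · intro i j hj hi k
    rcases eq_or_ne i j with rfl | hij
    · exact ⟨rfl, rfl⟩
    have haij : s i (a j) = a j := hsa_far i j hij hj hi
    have haji : s j (a i) = a i := hsa_far j i hij.symm hi hj
    have hFij : s i (F j) = F j := hsF i j hj hi
    have hFji : s j (F i) = F i := hsF j i hi hj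
    constructor
    · simp only [hsa i k, hsa j k, map_mul, map_zpow₀, haij, haji]
      rw [← mul_assoc, ← mul_assoc, (hzc _ _ _).eq]
    · by_cases hik : i = k + 1
      · by_cases hkj : k = j + 1
        · simp only [hs_left i k hik, hs_right j k hkj, map_mul, map_add, map_inv₀, map_one, haij,
            haji, hFij, hFji, mul_assoc]
        · have hjk := hsF j k hkj (fun h => hij (hik.trans h.symm))
          simp only [hs_left i k hik, hjk, map_mul, map_add, map_inv₀, map_one, haji, hFji]
      · by_cases hki : k = i + 1
        · by_cases hjk : j = k + 1
          · simp only [hs_left j k hjk, hs_right i k hki, map_mul, map_add, map_inv₀, map_one,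
              haij, haji, hFij, hFji, mul_assoc]
          · have hjk := hsF j k (fun h => hij (add_right_cancel (hki.symm.trans h))) hjk
            simp only [hs_right i k hki, hjk, map_mul, map_add, map_inv₀, map_one, haji, hFji]
        · have hik' := hsF i k hki hik
          by_cases hjk : j = k + 1
          · simp only [hs_left j k hjk, hik', map_mul, map_add, map_inv₀, map_one, haij, hFij]
          · by_cases hkj : k = j + 1
            · simp only [hs_right j k hkj, hik', map_mul, map_add, map_inv₀, map_one, haij, hFij]
            · rw [hsF j k hkj hjk, hik', hsF j k hkj hjk]
end

section
/- Quantum dilogarithm pentagon identity (truncated form): for every N ≥ 1, in the algebra A one has ∏_{m=0}^{N-1}(1 + G q^m) · ∏_{m=0}^{N-1}(1 + F q^m) ≡ ∏_{m=0}^{N-1}(1 + F q^m) · ∏_{m=0}^{N-1}(1 + GF q^m) · ∏_{m=0}^{N-1}(1 + G q^m) modulo the two-sided ideal generated by q^N. (Within each of the displayed products the factors commute with one another, so their internal ordering is immaterial; the products are taken with m increasing.) -/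
/-- The defining relations of the quantum plane over `ℂ[q]` (with `q` central):
generators `F` (index `0`), `G` (index `1`), `q` (index `2`), and relations
`qF = Fq`, `qG = Gq`, `FG = qGF`. -/
inductive QPlaneRel : FreeAlgebra ℂ (Fin 3) → FreeAlgebra ℂ (Fin 3) → Prop
  | qF : QPlaneRel (FreeAlgebra.ι ℂ 2 * FreeAlgebra.ι ℂ 0)
      (FreeAlgebra.ι ℂ 0 * FreeAlgebra.ι ℂ 2)
  | qG : QPlaneRel (FreeAlgebra.ι ℂ 2 * FreeAlgebra.ι ℂ 1)
      (FreeAlgebra.ι ℂ 1 * FreeAlgebra.ι ℂ 2)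
  | FG : QPlaneRel (FreeAlgebra.ι ℂ 0 * FreeAlgebra.ι ℂ 1)
      (FreeAlgebra.ι ℂ 2 * (FreeAlgebra.ι ℂ 1 * FreeAlgebra.ι ℂ 0))

/-- The quantum plane algebra `A`, presented by generators `F, G, q` with
relations `qF = Fq`, `qG = Gq`, `FG = qGF`. -/
abbrev QPlane : Type := RingQuot QPlaneRel

/-- The generator `F` of the quantum plane. -/
noncomputable def Fgen : QPlane := RingQuot.mkRingHom QPlaneRel (FreeAlgebra.ι ℂ 0)

/-- The generator `G` of the quantum plane. -/
noncomputable def Ggen : QPlane := RingQuot.mkRingHom QPlaneRel (FreeAlgebra.ι ℂ 1)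

/-- The central generator `q` of the quantum plane. -/
noncomputable def qgen : QPlane := RingQuot.mkRingHom QPlaneRel (FreeAlgebra.ι ℂ 2)

section TruncatedQuantumDilogarithm

variable {B : Type*} [Ring B]

/-- The truncated quantum dilogarithm `∏_{m<N} (1 + x q^m)`, with `m` increasing. -/
def truncDilog (q : B) (N : ℕ) (x : B) : B :=
  ((List.range N).map (fun m => 1 + x * q ^ m)).prod

theorem truncDilog_succ (q : B) (N : ℕ) (x : B) :
    truncDilog q (N + 1) x = truncDilog q N x * (1 + x * q ^ N) := by
  simp [truncDilog, List.range_succ]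

theorem truncDilog_zero_right (q : B) (N : ℕ) : truncDilog q N 0 = 1 := by
  simp [truncDilog]

theorem map_truncDilog {C : Type*} [Ring C] (f : B →+* C) (q : B) (N : ℕ) (x : B) :
    f (truncDilog q N x) = truncDilog (f q) N (f x) := by
  induction N with
  | zero => simp [truncDilog]
  | succ n ih => simp [truncDilog_succ, ih]

/-- A semiconjugation by an element commuting with `q` passes to truncated dilogarithms. -/
theorem SemiconjBy.truncDilog {q a x y : B} (h : SemiconjBy a x y) (hq : Commute a q) (N : ℕ) :
    SemiconjBy a (truncDilog q N x) (truncDilog q N y) := by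
  induction N with
  | zero => simp [_root_.truncDilog]
  | succ n ih =>
    simp only [truncDilog_succ]
    exact ih.mul_right ((SemiconjBy.one_right a).add_right (h.mul_right (hq.pow_right n)))

/-- The functional equation of the dilogarithm when `q ^ N = 0`. -/
theorem truncDilog_eq_one_add_mul {q : B} {N : ℕ} (hN : q ^ N = 0) (x : B) :
    truncDilog q N x = (1 + x) * truncDilog q N (x * q) := by
  have h : truncDilog q (N + 1) x = (1 + x) * truncDilog q N (x * q) := by
    simp [truncDilog, List.range_succ_eq_map, Function.comp_def, pow_succ', mul_assoc]
  rw [← h, truncDilog_succ, hN, mul_zero, add_zero, mul_one]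

/-- One step of the scaling recursion for `truncDilog q N U * truncDilog q N V`. -/
theorem truncDilog_mul_truncDilog_step {q U V : B} {N : ℕ} (hN : q ^ N = 0)
    (hV : Commute V q) (h : V * (U * q) = U * V) :
    truncDilog q N U * truncDilog q N V =
      (1 + (U + V)) * (truncDilog q N (U * q) * truncDilog q N (V * q)) := by
  have hs : V * truncDilog q N (U * q) = truncDilog q N U * V :=
    SemiconjBy.truncDilog (show SemiconjBy V (U * q) U from h) hV N
  rw [truncDilog_eq_one_add_mul hN V, ← mul_assoc, mul_add, ← hs, mul_one,
    truncDilog_eq_one_add_mul hN U]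
  noncomm_ring

/-- The exponential property of the dilogarithm for `q`-commuting `U`, `V`, when `q ^ N = 0`. -/
theorem truncDilog_add {q U V : B} {N : ℕ} (hN : q ^ N = 0)
    (hU : Commute U q) (hV : Commute V q) (h : U * V = q * (V * U)) :
    truncDilog q N (U + V) = truncDilog q N U * truncDilog q N V := by
  have key : ∀ k, truncDilog q N U * truncDilog q N V =
      truncDilog q k (U + V) *
        (truncDilog q N (U * q ^ k) * truncDilog q N (V * q ^ k)) := by
    intro k
    induction k with
    | zero => simp [truncDilog]
    | succ k ih =>
      have hc : V * q ^ k * (U * q ^ k * q) = U * q ^ k * (V * q ^ k) := by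
        have h1 : V * (U * q) = U * V := by
          rw [h, ← mul_assoc, (hV.mul_left hU).eq]
        have hUq : Commute (q ^ k) (U * q) :=
          ((hU.mul_left (Commute.refl q)).pow_right k).symm
        rw [mul_assoc U, ← pow_succ, pow_succ', ← mul_assoc U, hUq.mul_mul_mul_comm, h1,
          (hV.pow_right k).symm.mul_mul_mul_comm]
      rw [ih, truncDilog_mul_truncDilog_step hN
        (hV.mul_left ((Commute.refl q).pow_left k)) hc, truncDilog_succ, ← add_mul]
      simp only [pow_succ, mul_assoc]
  simpa [hN, truncDilog_zero_right] using (key N).symm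

/-- The pentagon identity in a ring where `q ^ N = 0`. -/
theorem truncDilog_pentagon {q F G : B} {N : ℕ} (hN : q ^ N = 0)
    (hF : Commute F q) (hG : Commute G q) (h : F * G = q * (G * F)) :
    truncDilog q N G * truncDilog q N F =
      truncDilog q N F * truncDilog q N (G * F) * truncDilog q N G := by
  have hGq : Commute (truncDilog q N G) q :=
    (SemiconjBy.truncDilog (show SemiconjBy q G G from hG.symm) (Commute.refl q) N).symm
  have hFG : F * truncDilog q N G = truncDilog q N (G * q) * F :=
    SemiconjBy.truncDilog
      (show F * G = G * q * F by rw [h, ← mul_assoc, hG.eq]) hF N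
  have hconj : SemiconjBy (truncDilog q N G) F (F + G * F) := by
    change truncDilog q N G * F = (F + G * F) * truncDilog q N G
    rw [← one_add_mul, mul_assoc, hFG, ← mul_assoc, ← truncDilog_eq_one_add_mul hN]
  rw [(hconj.truncDilog hGq N).eq, truncDilog_add hN hF (hG.mul_left hF)]
  rw [← mul_assoc, h, mul_assoc]

end TruncatedQuantumDilogarithm

theorem commute_Fgen_qgen : Commute Fgen qgen := by
  simpa only [Commute, SemiconjBy, Fgen, qgen, map_mul] using
    (RingQuot.mkRingHom_rel QPlaneRel.qF).symm

theorem commute_Ggen_qgen : Commute Ggen qgen := by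
  simpa only [Commute, SemiconjBy, Ggen, qgen, map_mul] using
    (RingQuot.mkRingHom_rel QPlaneRel.qG).symm

theorem Fgen_mul_Ggen : Fgen * Ggen = qgen * (Ggen * Fgen) := by
  simpa only [Fgen, Ggen, qgen, map_mul] using RingQuot.mkRingHom_rel QPlaneRel.FG

/-- quantum dilogarithm pentagon identity (truncated form):
for every `N ≥ 1`,
`∏_{m<N}(1 + G q^m) · ∏_{m<N}(1 + F q^m)`
`≡ ∏_{m<N}(1 + F q^m) · ∏_{m<N}(1 + GF q^m) · ∏_{m<N}(1 + G q^m)`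
modulo the two-sided ideal generated by `q^N` (products taken with `m`
increasing). -/
theorem quantum_pentagon_truncated (N : ℕ) (hN : 1 ≤ N) :
    ((List.range N).map (fun m => 1 + Ggen * qgen ^ m)).prod *
        ((List.range N).map (fun m => 1 + Fgen * qgen ^ m)).prod -
      ((List.range N).map (fun m => 1 + Fgen * qgen ^ m)).prod *
        ((List.range N).map (fun m => 1 + Ggen * Fgen * qgen ^ m)).prod *
        ((List.range N).map (fun m => 1 + Ggen * qgen ^ m)).prod
      ∈ TwoSidedIdeal.span {qgen ^ N} := by
  set I : TwoSidedIdeal QPlane := TwoSidedIdeal.span {qgen ^ N}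
  let π : QPlane →+* I.ringCon.Quotient := I.ringCon.mk'
  have mem_iff (x : QPlane) : x ∈ I ↔ π x = 0 := by
    rw [← TwoSidedIdeal.mem_ker, TwoSidedIdeal.ker_ringCon_mk']
  have hq : π qgen ^ N = 0 := by
    rw [← map_pow, ← mem_iff]
    exact TwoSidedIdeal.subset_span rfl
  have hFG : π Fgen * π Ggen = π qgen * (π Ggen * π Fgen) := by
    simp only [← map_mul, Fgen_mul_Ggen]
  change truncDilog qgen N Ggen * truncDilog qgen N Fgen -
    truncDilog qgen N Fgen * truncDilog qgen N (Ggen * Fgen) * truncDilog qgen N Ggen ∈ I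
  rw [mem_iff, map_sub, sub_eq_zero]
  simpa only [map_mul, map_truncDilog] using truncDilog_pentagon hq
    (commute_Fgen_qgen.map π) (commute_Ggen_qgen.map π) hFG
end

section
/- Invariants of the quantum A_2^{(1)} system: the element c := F_0 F_1 F_2 commutes with each of F_0, F_1, F_2, and both c and p := a_0 a_1 a_2 are invariant under the extended affine Weyl group action: s_i(c) = c, s_i(p) = p for i = 0, 1, 2, and ω(c) = c, ω(p) = p. -/
theorem commute_mul_mul_of_q_commute {D : Type*} [DivisionRing D] {q x y z : D}
    (hq : q ≠ 0) (hqc : ∀ t, q * t = t * q)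
    (hxy : x * y = q⁻¹ * (y * x)) (hzx : z * x = q⁻¹ * (x * z)) :
    Commute (x * y * z) x := by
  have hyx : y * x = q * (x * y) := by rw [hxy, mul_inv_cancel_left₀ hq]
  have hxz : x * z = q * (z * x) := by rw [hzx, mul_inv_cancel_left₀ hq]
  have hqxy : Commute q (x * y) := hqc _
  calc x * y * z * x = q⁻¹ * (q * (x * y)) * (z * x) := by
        rw [inv_mul_cancel_left₀ hq, mul_assoc (x * y)]
    _ = q⁻¹ * (x * y) * (q * (z * x)) := by rw [hqxy.eq]; simp only [mul_assoc]
    _ = x * (q⁻¹ * (y * x)) * z := by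
        have hqx : Commute q⁻¹ x := Commute.inv_left₀ (hqc x)
        rw [← hxz, ← mul_assoc x q⁻¹, ← hqx.eq]; simp only [mul_assoc]
    _ = x * (x * y * z) := by rw [← hxy]; simp only [mul_assoc]

theorem mul_mul_cyclic_of_commute {D : Type*} [DivisionRing D] {x y z : D} (hx : x ≠ 0)
    (h : Commute (x * y * z) x) : x * y * z = y * z * x := by
  apply mul_left_cancel₀ hx
  rw [← h.eq]
  simp only [mul_assoc]

/-- A ring automorphism which rescales the outer factors of a product `x * y * z` by mutually
inverse elements commuting with the product, and fixes the middle factor, fixes the product. -/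
theorem map_mul_mul_eq_self {D : Type*} [DivisionRing D] (s : D ≃+* D) {x y z u v : D}
    (hx : x ≠ 0) (hsx : s x = u * v⁻¹ * x) (hsy : s y = y) (hsz : s z = z * (v * u⁻¹))
    (hu : Commute (x * y * z) u) (hv : Commute (x * y * z) v) :
    s (x * y * z) = x * y * z := by
  have hne : s x ≠ 0 := (map_ne_zero s).2 hx
  have hu0 : u ≠ 0 := by rintro rfl; simp [hsx] at hne
  have hv0 : v ≠ 0 := by rintro rfl; simp [hsx] at hne
  calc s (x * y * z) = u * v⁻¹ * (x * y * z * v) * u⁻¹ := by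
        rw [map_mul, map_mul, hsx, hsy, hsz]; simp only [mul_assoc]
    _ = u * (x * y * z) * u⁻¹ := by
        rw [hv.eq, mul_assoc u, inv_mul_cancel_left₀ hv0]
    _ = x * y * z := by rw [← hu.eq, mul_inv_cancel_right₀ hu0]

/-- invariants of the quantum `A_2^(1)` system: `c = F_0F_1F_2`
commutes with each `F_i`, and both `c` and `p = a_0a_1a_2` are invariant under
the extended affine Weyl group action: `s_i(c) = c`, `s_i(p) = p` for
`i = 0, 1, 2`, and `ω(c) = c`, `ω(p) = p`. -/
theorem qA2_invariants {D : Type*} [DivisionRing D]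
    (q : D) (a F : Fin 3 → D)
    (hq : q ≠ 0) (hqc : ∀ x, q * x = x * q)
    (ha : ∀ i, a i ≠ 0) (hac : ∀ i x, a i * x = x * a i)
    (hF : ∀ i, F i ≠ 0)
    (hFF : ∀ i, F i * F (i + 1) = q⁻¹ * (F (i + 1) * F i))
    (s : Fin 3 → (D ≃+* D)) (hsq : ∀ i, s i q = q)
    (hsai : ∀ i, s i (a i) = (a i)⁻¹)
    (hsar : ∀ i, s i (a (i + 1)) = a i * a (i + 1))
    (hsal : ∀ i, s i (a (i - 1)) = a i * a (i - 1))
    (hsFi : ∀ i, s i (F i) = F i)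
    (hsFl : ∀ i, s i (F (i - 1)) = (1 + a i * F i) * (a i + F i)⁻¹ * F (i - 1))
    (hsFr : ∀ i, s i (F (i + 1)) = F (i + 1) * ((a i + F i) * (1 + a i * F i)⁻¹))
    (ω : D ≃+* D) (hωq : ω q = q)
    (hωa : ∀ i, ω (a i) = a (i + 1)) (hωF : ∀ i, ω (F i) = F (i + 1))
    :
    let p : D := a 0 * a 1 * a 2
    let c : D := F 0 * F 1 * F 2
    (∀ i, c * F i = F i * c) ∧
    (∀ i, s i c = c) ∧ (∀ i, s i p = p) ∧
    ω c = c ∧ ω p = p := by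
  intro p c
  have hcomm (i) : Commute (F i * F (i + 1) * F (i + 2)) (F i) := by
    refine commute_mul_mul_of_q_commute hq hqc (hFF i) ?_
    have h := hFF (i + 2)
    rwa [show i + 2 + 1 = i by lia] at h
  have h₀ : c = F 1 * F 2 * F 0 := mul_mul_cyclic_of_commute (hF 0) (hcomm 0)
  have h₁ : c = F 2 * F 0 * F 1 := h₀.trans (mul_mul_cyclic_of_commute (hF 1) (hcomm 1))
  have hc (i) : Commute c (F i) := by
    fin_cases i
    · exact hcomm 0
    · exact h₀ ▸ hcomm 1
    · exact h₁ ▸ hcomm 2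
  have hprod (i) : F (i - 1) * F i * F (i + 1) = c := by
    fin_cases i
    · exact h₁.symm
    · rfl
    · exact h₀.symm
  have hp (i) : a i * a (i + 1) * a (i - 1) = p := by
    fin_cases i
    · rfl
    · change a 1 * a 2 * a 0 = a 0 * a 1 * a 2
      rw [← hac 0, mul_assoc]
    · change a 2 * a 0 * a 1 = a 0 * a 1 * a 2
      rw [mul_assoc, hac 2]
  refine ⟨fun i => (hc i).eq, fun i => ?_, fun i => ?_, ?_, ?_⟩
  · have hca : Commute c (a i) := (hac i c).symm
    rw [← hprod i] at hca ⊢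
    have hcF := hprod i ▸ hc i
    exact map_mul_mul_eq_self (s i) (hF _) (hsFl i) (hsFi i) (hsFr i)
      ((Commute.one_right _).add_right (hca.mul_right hcF)) (hca.add_right hcF)
  · rw [← hp i, map_mul, map_mul, hsai, hsar, hsal, inv_mul_cancel_left₀ (ha i),
      ← mul_assoc, ← hac i]
  · simp only [c, map_mul, hωF]
    exact h₀.symm
  · simp only [p, map_mul, hωa]
    exact hp 1
end
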